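/- Let A be a complex Banach algebra with a contractive right approximate identity, and let B_A(A*) = {T ∈ B(A*) : T(φ·a) = (Tφ)·a for all φ ∈ A*, a ∈ A} be the algebra of bounded right A-module maps on A* (a Banach algebra under composition and the operator norm). Then: (1) for μ in the dual LUC(A*)* and ψ ∈ LUC(A*), the functional μ◻ψ defined by ⟨μ◻ψ, a⟩ = ⟨μ, ψ·a⟩ belongs to LUC(A*), so LUC(A*)* carries the first Arens product ⟨μ◻ν, ψ⟩ = ⟨μ, ν◻ψ⟩; (2) there is a (unique) surjective isometric algebra isomorphism Θ : B_A(A*) → (LUC(A*)*, ◻) determined by ⟨Θ(T), φ·a⟩ = ⟨Tφ, a⟩ for all φ ∈ A*, a ∈ A, and Θ is a homeomorphism from the topology on B_A(A*) generated by the functionals T ↦ Σ_n ⟨Tφ_n, a_n⟩ (over sequences with Σ_n ‖φ_n‖‖a_n‖ < ∞) onto the weak* topology of LUC(A*)*; (3) B_A(A*) equals the closure, in B(A*) with this topology, of {Γ(a) : a ∈ A}, where Γ(a)(φ) = a·φ and ⟨a·φ, b⟩ = ⟨φ, ba⟩. -/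

import Mathlib

open scoped Topology
open Filter

noncomputable section

/-- The right dual action of `A` on `A*`: `(φ · a) b = φ (a * b)`. -/
def dAct {A : Type*} [NonUnitalNormedRing A] [NormedSpace ℂ A]
    [IsScalarTower ℂ A A] [SMulCommClass ℂ A A]
    (φ : A →L[ℂ] ℂ) (a : A) : A →L[ℂ] ℂ :=
  φ.comp (ContinuousLinearMap.mul ℂ A a)

/-- The canonical map `η : A → S*`, `⟨η a, φ⟩ = ⟨ι φ, a⟩`. -/
def etaMap {A : Type*} [NonUnitalNormedRing A] [NormedSpace ℂ A]
    [IsScalarTower ℂ A A] [SMulCommClass ℂ A A]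
    {S : Type*} [NormedAddCommGroup S] [NormedSpace ℂ S]
    (ι : S →ₗ[ℂ] (A →L[ℂ] ℂ)) (hι : ∀ φ : S, ‖ι φ‖ ≤ ‖φ‖) (a : A) : S →L[ℂ] ℂ :=
  LinearMap.mkContinuous
    { toFun := fun φ => ι φ a
      map_add' := fun φ ψ => by simp
      map_smul' := fun c φ => by simp }
    ‖a‖
    (fun φ => by
      have h1 : ‖ι φ a‖ ≤ ‖ι φ‖ * ‖a‖ := (ι φ).le_opNorm a
      have h2 : ‖ι φ‖ * ‖a‖ ≤ ‖φ‖ * ‖a‖ :=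
        mul_le_mul_of_nonneg_right (hι φ) (norm_nonneg a)
      calc ‖ι φ a‖ ≤ ‖φ‖ * ‖a‖ := h1.trans h2
        _ = ‖a‖ * ‖φ‖ := mul_comm _ _)

/-- The "identity" map from the normed dual to the weak-star dual. -/
def toW {S : Type*} [NormedAddCommGroup S] [NormedSpace ℂ S] (μ : S →L[ℂ] ℂ) :
    WeakDual ℂ S := StrongDual.toWeakDual μ

/-- The "identity" map from the weak-star dual to the normed dual. -/
def ofW {S : Type*} [NormedAddCommGroup S] [NormedSpace ℂ S] (μ : WeakDual ℂ S) :
    S →L[ℂ] ℂ := WeakDual.toStrongDual μ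

/-- coefficient functional `x* · x` of a module action: `(x* · x) a = x* (x · a)`. -/
def coeffFn {A : Type*} [NonUnitalNormedRing A] [NormedSpace ℂ A]
    [IsScalarTower ℂ A A] [SMulCommClass ℂ A A]
    {X : Type*} [NormedAddCommGroup X] [NormedSpace ℂ X]
    (m : X →L[ℂ] A →L[ℂ] X) (xs : X →L[ℂ] ℂ) (x : X) : A →L[ℂ] ℂ :=
  xs.comp (m x)

/-- Membership in the Fourier space `F_q(A*)`. -/
def FqMem {A : Type*} [NonUnitalNormedRing A] [NormedSpace ℂ A]
    [IsScalarTower ℂ A A] [SMulCommClass ℂ A A]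
    {X : Type*} [NormedAddCommGroup X] [NormedSpace ℂ X]
    (m : X →L[ℂ] A →L[ℂ] X) (φ : A →L[ℂ] ℂ) : Prop :=
  ∃ (xs : ℕ → (X →L[ℂ] ℂ)) (x : ℕ → X),
    (Summable fun n => ‖xs n‖ * ‖x n‖) ∧
    ∀ a : A, HasSum (fun n => xs n (m (x n) a)) (φ a)

/-- The Fourier norm `‖·‖_q`. -/
def qNorm {A : Type*} [NonUnitalNormedRing A] [NormedSpace ℂ A]
    [IsScalarTower ℂ A A] [SMulCommClass ℂ A A]
    {X : Type*} [NormedAddCommGroup X] [NormedSpace ℂ X]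
    (m : X →L[ℂ] A →L[ℂ] X) (φ : A →L[ℂ] ℂ) : ℝ :=
  sInf { c : ℝ | ∃ (xs : ℕ → (X →L[ℂ] ℂ)) (x : ℕ → X),
    (Summable fun n => ‖xs n‖ * ‖x n‖) ∧
    (∀ a : A, HasSum (fun n => xs n (m (x n) a)) (φ a)) ∧
    c = ∑' n, ‖xs n‖ * ‖x n‖ }

/-- The weak-star topology on `B(X*)` via its identification with `(X* ⊗ X)*`:
the coarsest topology making `T ↦ Σₙ ⟨T xₙ*, xₙ⟩` continuous for all absolutely
summable sequences. -/
def wstarT (X : Type*) [NormedAddCommGroup X] [NormedSpace ℂ X] :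
    TopologicalSpace ((X →L[ℂ] ℂ) →L[ℂ] (X →L[ℂ] ℂ)) :=
  ⨅ (p : (ℕ → (X →L[ℂ] ℂ)) × (ℕ → X)) (_ : Summable fun n => ‖p.1 n‖ * ‖p.2 n‖),
    TopologicalSpace.induced (fun T => ∑' n, T (p.1 n) (p.2 n)) inferInstance

/-- `Γ_q : A → B(X*)`, `Γ_q(a)(x*) = a · x*`, i.e. `Γ_q(a)(x*)(x) = x*(x · a)`. -/
def GammaQ {A : Type*} [NonUnitalNormedRing A] [NormedSpace ℂ A]
    [IsScalarTower ℂ A A] [SMulCommClass ℂ A A]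
    {X : Type*} [NormedAddCommGroup X] [NormedSpace ℂ X]
    (m : X →L[ℂ] A →L[ℂ] X) (a : A) : (X →L[ℂ] ℂ) →L[ℂ] (X →L[ℂ] ℂ) :=
  (ContinuousLinearMap.compL ℂ X X ℂ).flip (m.flip a)

/-- `M_q`: the weak-star closure of `Γ_q(A)` in `B(X*)`. -/
def Mq {A : Type*} [NonUnitalNormedRing A] [NormedSpace ℂ A]
    [IsScalarTower ℂ A A] [SMulCommClass ℂ A A]
    {X : Type*} [NormedAddCommGroup X] [NormedSpace ℂ X]
    (m : X →L[ℂ] A →L[ℂ] X) : Set ((X →L[ℂ] ℂ) →L[ℂ] (X →L[ℂ] ℂ)) :=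
  @closure _ (wstarT X) (Set.range fun a : A => GammaQ m a)

/-- `Γ : A → B(A*)`, `Γ(a)(φ) = a·φ`, i.e. `⟨a·φ, b⟩ = ⟨φ, b a⟩`. -/
def GammaA (A : Type*) [NonUnitalNormedRing A] [NormedSpace ℂ A]
    [IsScalarTower ℂ A A] [SMulCommClass ℂ A A] (a : A) :
    (A →L[ℂ] ℂ) →L[ℂ] (A →L[ℂ] ℂ) :=
  (ContinuousLinearMap.compL ℂ A A ℂ).flip ((ContinuousLinearMap.mul ℂ A).flip a)

/-- The algebra of bounded right `A`-module maps on `A*`. -/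
def BAset (A : Type*) [NonUnitalNormedRing A] [NormedSpace ℂ A]
    [IsScalarTower ℂ A A] [SMulCommClass ℂ A A] :
    Set ((A →L[ℂ] ℂ) →L[ℂ] (A →L[ℂ] ℂ)) :=
  {T | ∀ (φ : A →L[ℂ] ℂ) (a : A), T (dAct φ a) = dAct (T φ) a}

section Helpers16

variable {A : Type*} [NonUnitalNormedRing A] [NormedSpace ℂ A]
    [IsScalarTower ℂ A A] [SMulCommClass ℂ A A]

theorem dAct_apply' (φ : A →L[ℂ] ℂ) (a b : A) : dAct φ a b = φ (a * b) := rfl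

theorem dAct_norm_le (φ : A →L[ℂ] ℂ) (a : A) : ‖dAct φ a‖ ≤ ‖φ‖ * ‖a‖ := by
  refine ContinuousLinearMap.opNorm_le_bound _ (by positivity) fun b => ?_
  rw [dAct_apply', mul_assoc]
  exact (φ.le_opNorm _).trans (mul_le_mul_of_nonneg_left (norm_mul_le a b) (norm_nonneg _))

theorem dAct_dAct (φ : A →L[ℂ] ℂ) (a b : A) : dAct (dAct φ a) b = dAct φ (a * b) := by
  ext c; simp [dAct_apply', mul_assoc]

theorem dAct_add_left (φ ψ : A →L[ℂ] ℂ) (a : A) : dAct (φ + ψ) a = dAct φ a + dAct ψ a := by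
  ext c; simp [dAct_apply']

theorem dAct_sub_left (φ ψ : A →L[ℂ] ℂ) (a : A) : dAct (φ - ψ) a = dAct φ a - dAct ψ a := by
  ext c; simp [dAct_apply']

theorem dAct_smul_left (c : ℂ) (φ : A →L[ℂ] ℂ) (a : A) : dAct (c • φ) a = c • dAct φ a := by
  ext c; simp [dAct_apply']

theorem dAct_add_right (φ : A →L[ℂ] ℂ) (a b : A) : dAct φ (a + b) = dAct φ a + dAct φ b := by
  ext c; simp [dAct_apply', add_mul]

theorem dAct_sub_right (φ : A →L[ℂ] ℂ) (a b : A) : dAct φ (a - b) = dAct φ a - dAct φ b := by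
  ext c; simp [dAct_apply', sub_mul]

theorem dAct_smul_right (c : ℂ) (φ : A →L[ℂ] ℂ) (a : A) : dAct φ (c • a) = c • dAct φ a := by
  ext c; simp [dAct_apply', smul_mul_assoc]

/-- A mixed-unit type functional. -/
theorem exists_mixed_unit
    (hrai : ∃ F : Filter A, F.NeBot ∧ (∀ᶠ e in F, ‖e‖ ≤ 1) ∧
      ∀ a : A, Tendsto (fun e => a * e) F (𝓝 a)) :
    ∃ E : (A →L[ℂ] ℂ) →L[ℂ] ℂ, ‖E‖ ≤ 1 ∧ ∀ φ a, E (dAct φ a) = φ a := by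
  obtain ⟨F, hF, hb, hlim⟩ := hrai
  let G := Ultrafilter.of F
  have hG : (G : Filter A) ≤ F := Ultrafilter.of_le F
  have key : ∀ φ : A →L[ℂ] ℂ, ∃ z : ℂ, Tendsto (fun e => φ e) G (𝓝 z) ∧ ‖z‖ ≤ ‖φ‖ := by
    intro φ
    have hc := isCompact_closedBall (0 : ℂ) ‖φ‖
    have := hc.ultrafilter_le_nhds (G.map φ) (by
      rw [le_principal_iff]
      show φ ⁻¹' _ ∈ G
      filter_upwards [hG hb] with e he
      simp only [Set.mem_preimage, mem_closedBall_zero_iff]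
      calc ‖φ e‖ ≤ ‖φ‖ * ‖e‖ := φ.le_opNorm e
        _ ≤ ‖φ‖ * 1 := mul_le_mul_of_nonneg_left he (norm_nonneg _)
        _ = ‖φ‖ := mul_one _)
    obtain ⟨z, hz, hz2⟩ := this
    exact ⟨z, hz2, by simpa using hz⟩
  choose L hL hLn using key
  refine ⟨LinearMap.mkContinuous
    { toFun := L
      map_add' := fun φ ψ => tendsto_nhds_unique (hL _) ((hL φ).add (hL ψ))
      map_smul' := fun c φ => tendsto_nhds_unique (hL _) ((hL φ).const_smul c) } 1
      (fun φ => by simpa using hLn φ), LinearMap.mkContinuous_norm_le _ zero_le_one _, ?_⟩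
  intro φ a
  refine tendsto_nhds_unique (hL (dAct φ a)) ?_
  exact (φ.continuous.tendsto a).comp ((hlim a).mono_left hG)

variable {U : Type*} [NormedAddCommGroup U] [NormedSpace ℂ U]

theorem gen_ext [CompleteSpace U] (ι : U →ₗᵢ[ℂ] (A →L[ℂ] ℂ))
    (hr : Set.range ι ⊆ closure
      (Submodule.span ℂ {ψ : A →L[ℂ] ℂ | ∃ (φ : A →L[ℂ] ℂ) (a : A), ψ = dAct φ a} :
        Set (A →L[ℂ] ℂ)))
    (hgen : ∀ (φ : A →L[ℂ] ℂ) (a : A), ∃ u : U, ι u = dAct φ a)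
    (K : Submodule ℂ U) (hK : IsClosed (K : Set U))
    (h : ∀ φ a u, ι u = dAct φ a → u ∈ K) (u : U) : u ∈ K := by
  have hcl : IsClosed (ι '' (K : Set U)) :=
    ι.isometry.isClosedEmbedding.isClosedMap _ hK
  have h1 : (Submodule.span ℂ {ψ : A →L[ℂ] ℂ | ∃ (φ : A →L[ℂ] ℂ) (a : A), ψ = dAct φ a})
      ≤ K.map ι.toLinearMap := by
    rw [Submodule.span_le]
    rintro _ ⟨φ, a, rfl⟩
    obtain ⟨w, hw⟩ := hgen φ a
    exact ⟨w, h _ _ _ hw, hw⟩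
  obtain ⟨w, hw, hwu⟩ := closure_minimal (fun x hx => h1 hx) hcl (hr ⟨u, rfl⟩)
  rwa [← ι.injective hwu]

/-- The operator attached to a functional on `LUC`. -/
theorem exists_opT (ι : U →ₗᵢ[ℂ] (A →L[ℂ] ℂ))
    (hgen : ∀ (φ : A →L[ℂ] ℂ) (a : A), ∃ u : U, ι u = dAct φ a) (μ : U →L[ℂ] ℂ) :
    ∃ T ∈ BAset A, ∀ φ a u, ι u = dAct φ a → T φ a = μ u := by
  choose g hg using hgen
  have hga : ∀ φ a u, ι u = dAct φ a → u = g φ a := fun φ a u h =>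
    ι.injective (h.trans (hg φ a).symm)
  let T : (A →L[ℂ] ℂ) →L[ℂ] (A →L[ℂ] ℂ) := LinearMap.mkContinuous₂
    (LinearMap.mk₂ ℂ (fun φ a => μ (g φ a))
      (fun φ ψ a => by
        rw [← map_add]; congr 1; symm; apply hga; rw [map_add, hg, hg, dAct_add_left])
      (fun c φ a => by
        rw [← map_smul]; congr 1; symm; apply hga; rw [map_smul, hg, dAct_smul_left])
      (fun φ a b => by
        rw [← map_add]; congr 1; symm; apply hga; rw [map_add, hg, hg, dAct_add_right])
      (fun c φ a => by
        rw [← map_smul]; congr 1; symm; apply hga; rw [map_smul, hg, dAct_smul_right]))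
    ‖μ‖ (fun φ a => by
      have h1 : ‖μ (g φ a)‖ ≤ ‖μ‖ * ‖g φ a‖ := μ.le_opNorm _
      have h2 : ‖g φ a‖ ≤ ‖φ‖ * ‖a‖ := by
        rw [← ι.norm_map, hg]; exact dAct_norm_le φ a
      rw [mul_assoc]
      exact h1.trans (mul_le_mul_of_nonneg_left h2 (norm_nonneg _)))
  have hT : ∀ φ a, T φ a = μ (g φ a) := fun φ a => rfl
  refine ⟨T, ?_, fun φ a u h => by rw [hT, hga φ a u h]⟩
  intro φ a
  ext b
  rw [dAct_apply', hT, hT]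
  congr 1
  apply hga
  rw [hg, dAct_dAct]

theorem opT_range [CompleteSpace U] (ι : U →ₗᵢ[ℂ] (A →L[ℂ] ℂ))
    (hr : Set.range ι ⊆ closure
      (Submodule.span ℂ {ψ : A →L[ℂ] ℂ | ∃ (φ : A →L[ℂ] ℂ) (a : A), ψ = dAct φ a} :
        Set (A →L[ℂ] ℂ)))
    (hgen : ∀ (φ : A →L[ℂ] ℂ) (a : A), ∃ u : U, ι u = dAct φ a)
    (T : (A →L[ℂ] ℂ) →L[ℂ] (A →L[ℂ] ℂ)) (hT : T ∈ BAset A) (u : U) :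
    ∃ w, ι w = T (ι u) := by
  have := gen_ext ι hr hgen ((LinearMap.range ι.toLinearMap).comap (T.toLinearMap ∘ₗ ι.toLinearMap))
    (by
      have hcl : IsClosed (Set.range ι) := ι.isometry.isClosedEmbedding.isClosed_range
      exact hcl.preimage (T.continuous.comp ι.continuous))
    (by
      intro φ a u hu
      obtain ⟨w, hw⟩ := hgen (T φ) a
      refine ⟨w, ?_⟩
      show ι w = T (ι u)
      rw [hw, hu, hT]) u
  exact this

/-- Right approximation on `LUC`. -/
theorem approx_unit [CompleteSpace U] (ι : U →ₗᵢ[ℂ] (A →L[ℂ] ℂ))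
    (hr : Set.range ι ⊆ closure
      (Submodule.span ℂ {ψ : A →L[ℂ] ℂ | ∃ (φ : A →L[ℂ] ℂ) (a : A), ψ = dAct φ a} :
        Set (A →L[ℂ] ℂ)))
    (hgen : ∀ (φ : A →L[ℂ] ℂ) (a : A), ∃ u : U, ι u = dAct φ a)
    (F : Filter A) (hb : ∀ᶠ e in F, ‖e‖ ≤ 1)
    (hlim : ∀ a : A, Tendsto (fun e => a * e) F (𝓝 a)) (u : U) :
    Tendsto (fun e => dAct (ι u) e) F (𝓝 (ι u)) := by
  let K : Submodule ℂ U :=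
    { carrier := {u | Tendsto (fun e => dAct (ι u) e) F (𝓝 (ι u))}
      add_mem' := by
        intro a b ha hb
        simp only [Set.mem_ofPred_eq, map_add, dAct_add_left] at *
        exact ha.add hb
      zero_mem' := by
        have : ∀ e : A, dAct (0 : A →L[ℂ] ℂ) e = 0 := fun e => by ext; simp [dAct_apply']
        simp [this, tendsto_const_nhds]
      smul_mem' := by
        intro c a ha
        simp only [Set.mem_ofPred_eq, map_smul, dAct_smul_left] at *
        exact ha.const_smul c }
  refine gen_ext ι hr hgen K ?_ ?_ u
  · rw [← isSeqClosed_iff_isClosed]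
    intro x y hx hxy
    show Tendsto (fun e => dAct (ι y) e) F (𝓝 (ι y))
    rw [Metric.tendsto_nhds]
    intro ε hε
    obtain ⟨n, hn⟩ := ((Metric.tendsto_nhds.1 hxy) (ε / 3) (by positivity)).exists
    have hxn : Tendsto (fun e => dAct (ι (x n)) e) F (𝓝 (ι (x n))) := hx n
    rw [Metric.tendsto_nhds] at hxn
    filter_upwards [hb, hxn (ε / 3) (by positivity)] with e he1 he2
    have h1 : dist (ι (x n)) (ι y) < ε / 3 := by rwa [ι.isometry.dist_eq]
    have h3 : dist (dAct (ι y) e) (dAct (ι (x n)) e) < ε / 3 := by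
      rw [dist_comm, dist_eq_norm, ← dAct_sub_left]
      rw [dist_eq_norm] at h1
      calc _ ≤ _ := dAct_norm_le _ _
        _ ≤ ‖ι (x n) - ι y‖ * 1 := mul_le_mul_of_nonneg_left he1 (norm_nonneg _)
        _ < ε / 3 := by rwa [mul_one]
    have := dist_triangle4 (dAct (ι y) e) (dAct (ι (x n)) e) (ι (x n)) (ι y)
    linarith
  · intro φ a u hu
    show Tendsto (fun e => dAct (ι u) e) F (𝓝 (ι u))
    rw [hu]
    simp only [dAct_dAct]
    have : Continuous (fun b : A => dAct φ b) := by
      refine (LipschitzWith.of_dist_le_mul (K := ‖φ‖₊) fun a b => ?_).continuous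
      rw [dist_eq_norm, dist_eq_norm, ← dAct_sub_right]
      exact dAct_norm_le _ _
    exact (this.tendsto a).comp (hlim a)

/-- Every element of `LUC` is an absolutely convergent sum of `φₙ·aₙ`. -/
theorem exists_series [CompleteSpace U] (ι : U →ₗᵢ[ℂ] (A →L[ℂ] ℂ))
    (hr : Set.range ι ⊆ closure
      (Submodule.span ℂ {ψ : A →L[ℂ] ℂ | ∃ (φ : A →L[ℂ] ℂ) (a : A), ψ = dAct φ a} :
        Set (A →L[ℂ] ℂ)))
    (hgen : ∀ (φ : A →L[ℂ] ℂ) (a : A), ∃ u : U, ι u = dAct φ a)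
    (hrai : ∃ F : Filter A, F.NeBot ∧ (∀ᶠ e in F, ‖e‖ ≤ 1) ∧
      ∀ a : A, Tendsto (fun e => a * e) F (𝓝 a)) (u : U) :
    ∃ p : (ℕ → (A →L[ℂ] ℂ)) × (ℕ → A), (Summable fun n => ‖p.1 n‖ * ‖p.2 n‖) ∧
      HasSum (fun n => dAct (p.1 n) (p.2 n)) (ι u) := by
  obtain ⟨F, hF, hb, hlim⟩ := hrai
  have step : ∀ (n : ℕ) (v : U), ∃ (e : A) (w : U), ‖e‖ ≤ 1 ∧ ι w = ι v - dAct (ι v) e ∧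
      ‖w‖ ≤ (1 / 2 : ℝ) ^ n := by
    intro n v
    have h := approx_unit ι hr hgen F hb hlim v
    rw [Metric.tendsto_nhds] at h
    obtain ⟨e, he1, he2⟩ := (hb.and (h ((1 / 2 : ℝ) ^ n) (by positivity))).exists
    obtain ⟨w, hw⟩ := hgen (ι v) e
    refine ⟨e, v - w, he1, by rw [map_sub, hw], ?_⟩
    rw [← ι.norm_map, map_sub, hw, ← dist_eq_norm, dist_comm]
    exact he2.le
  choose e w he hw hwn using step
  let v : ℕ → U := fun n => Nat.rec u (fun n v => w n v) n
  have hv0 : v 0 = u := rfl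
  have hvs : ∀ n, v (n + 1) = w n (v n) := fun n => rfl
  have hgeo : Summable fun n : ℕ => (1 / 2 : ℝ) ^ n := summable_geometric_two
  have hsv : Summable fun n => ‖v n‖ := by
    rw [← summable_nat_add_iff 1]
    exact Summable.of_nonneg_of_le (fun _ => norm_nonneg _) (fun n => hwn n (v n)) hgeo
  have hs : Summable fun n => ‖ι (v n)‖ * ‖e n (v n)‖ := by
    refine Summable.of_nonneg_of_le (fun _ => by positivity) (fun n => ?_) hsv
    rw [ι.norm_map]
    exact mul_le_of_le_one_right (norm_nonneg _) (he _ _)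
  refine ⟨(fun n => ι (v n), fun n => e n (v n)), hs, ?_⟩
  have hsum : Summable fun n => dAct (ι (v n)) (e n (v n)) :=
    Summable.of_norm_bounded hs fun n => dAct_norm_le _ _
  rw [hsum.hasSum_iff_tendsto_nat]
  have hpart : ∀ n, ∑ i ∈ Finset.range n, dAct (ι (v i)) (e i (v i)) = ι u - ι (v n) := by
    intro n
    induction n with
    | zero => simp [hv0]
    | succ n ih => rw [Finset.sum_range_succ, ih, hvs, hw]; abel
  simp only [hpart]
  have h0 : Tendsto v atTop (𝓝 0) := tendsto_zero_iff_norm_tendsto_zero.2 hsv.tendsto_atTop_zero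
  have := (ι.continuous.tendsto 0).comp h0
  simpa using (tendsto_const_nhds (x := ι u)).sub this

theorem wstarT_eval_continuous (X : Type*) [NormedAddCommGroup X] [NormedSpace ℂ X]
    (p : (ℕ → (X →L[ℂ] ℂ)) × (ℕ → X)) (hp : Summable fun n => ‖p.1 n‖ * ‖p.2 n‖) :
    @Continuous _ _ (wstarT X) _
      (fun T : (X →L[ℂ] ℂ) →L[ℂ] (X →L[ℂ] ℂ) => ∑' n, T (p.1 n) (p.2 n)) := by
  rw [continuous_iff_le_induced]
  exact iInf₂_le p hp

theorem wstarT_point_continuous (X : Type*) [NormedAddCommGroup X] [NormedSpace ℂ X]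
    (φ : X →L[ℂ] ℂ) (x : X) :
    @Continuous _ _ (wstarT X) _
      (fun T : (X →L[ℂ] ℂ) →L[ℂ] (X →L[ℂ] ℂ) => T φ x) := by
  have h0 : ∀ n ≠ 0, (Pi.single (M := fun _ : ℕ => X →L[ℂ] ℂ) 0 φ) n = 0 := fun n hn => by
    simp [Pi.single_eq_of_ne hn]
  have := wstarT_eval_continuous X (Pi.single 0 φ, Pi.single 0 x)
    (summable_of_ne_finset_zero (s := {0}) (fun n hn => by
      simp only [Finset.mem_singleton] at hn
      simp [h0 n hn]))
  convert this using 2 with T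
  rw [tsum_eq_single 0]
  · simp
  · intro n hn
    simp [h0 n hn]

theorem wstarT_closure (X : Type*) [NormedAddCommGroup X] [NormedSpace ℂ X]
    (s : Set ((X →L[ℂ] ℂ) →L[ℂ] (X →L[ℂ] ℂ))) (T : (X →L[ℂ] ℂ) →L[ℂ] (X →L[ℂ] ℂ))
    (h : ∀ I : Finset {p : (ℕ → (X →L[ℂ] ℂ)) × (ℕ → X) // Summable fun n => ‖p.1 n‖ * ‖p.2 n‖},
      ∃ S ∈ s, ∀ p ∈ I, ∑' n, S (p.1.1 n) (p.1.2 n) = ∑' n, T (p.1.1 n) (p.1.2 n)) :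
    T ∈ @closure _ (wstarT X) s := by
  have heq : wstarT X = TopologicalSpace.induced
      (fun (T : (X →L[ℂ] ℂ) →L[ℂ] (X →L[ℂ] ℂ))
        (p : {p : (ℕ → (X →L[ℂ] ℂ)) × (ℕ → X) // Summable fun n => ‖p.1 n‖ * ‖p.2 n‖}) =>
        ∑' n, T (p.1.1 n) (p.1.2 n)) inferInstance := by
    simp only [wstarT, Pi.topologicalSpace, induced_iInf, induced_compose, iInf_subtype]
    rfl
  rw [heq, closure_induced, mem_closure_iff_nhds]
  intro t ht
  rw [nhds_pi, Filter.mem_pi] at ht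
  obtain ⟨I, hI, t', ht', hsub⟩ := ht
  obtain ⟨S, hS, hST⟩ := h hI.toFinset
  refine ⟨_, hsub ?_, ⟨S, hS, rfl⟩⟩
  intro p hp
  show ∑' n, S (p.1.1 n) (p.1.2 n) ∈ t' p
  rw [hST p (hI.mem_toFinset.2 hp)]
  exact mem_of_mem_nhds (ht' p)

/-- Finite interpolation: a functional on `U` is finitely matched by evaluations. -/
theorem finite_match (ι : U →ₗᵢ[ℂ] (A →L[ℂ] ℂ)) (μ : U →L[ℂ] ℂ) {J : Type*}
    (I : Finset J) (u : J → U) : ∃ a : A, ∀ j ∈ I, ι (u j) a = μ (u j) := by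
  classical
  let L : A →ₗ[ℂ] (I → ℂ) := LinearMap.pi fun j => (ι (u j)).toLinearMap
  have : (fun j : I => μ (u j)) ∈ LinearMap.range L := by
    by_contra hn
    obtain ⟨f, hf, hle⟩ := Submodule.exists_le_ker_of_notMem hn
    apply hf
    have hfe : ∀ x : I → ℂ, f x = ∑ j, x j * f (Pi.single j 1) := by
      intro x
      conv_lhs => rw [pi_eq_sum_univ' x]
      simp
    have hz : ∑ j : I, f (Pi.single j 1) • u j = 0 := by
      apply ι.injective
      ext a
      have : f (L a) = 0 := hle ⟨a, rfl⟩
      rw [hfe] at this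
      simpa [L, mul_comm] using this
    rw [hfe]
    have := congrArg μ hz
    simpa [mul_comm] using this
  obtain ⟨a, ha⟩ := this
  exact ⟨a, fun j hj => congrFun ha ⟨j, hj⟩⟩

theorem GammaA_apply' (a : A) (φ : A →L[ℂ] ℂ) (b : A) : GammaA A a φ b = φ (b * a) := rfl

theorem GammaA_mem (a : A) : GammaA A a ∈ BAset A := by
  intro φ b
  ext c
  simp [GammaA_apply', dAct_apply', mul_assoc]

theorem BAset_closed : @IsClosed _ (wstarT A) (BAset A) := by
  letI := wstarT A
  have : BAset A = ⋂ (φ : A →L[ℂ] ℂ), ⋂ (a : A), ⋂ (b : A),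
      {T | T (dAct φ a) b = T φ (a * b)} := by
    ext T
    simp only [BAset, Set.mem_ofPred_eq, Set.mem_iInter]
    constructor
    · intro h φ a b
      rw [h]; rfl
    · intro h φ a
      ext b
      exact h φ a b
  rw [this]
  refine isClosed_iInter fun φ => isClosed_iInter fun a => isClosed_iInter fun b => ?_
  exact isClosed_eq (wstarT_point_continuous A _ _) (wstarT_point_continuous A _ _)

end Helpers16

/-- Let `A` be a complex Banach algebra with a contractive right
approximate identity, and let `U` be a realization of `LUC(A*)` (the closed linear
span of `{φ·a}` in `A*`, with the norm of `A*`).  Then: (1) for `μ ∈ LUC(A*)*` and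
`ψ ∈ LUC(A*)` the functional `μ◻ψ : a ↦ μ(ψ·a)` again lies in `LUC(A*)`, so
`LUC(A*)*` carries the first Arens product `⟨μ◻ν, ψ⟩ = ⟨μ, ν◻ψ⟩`; (2) there is a
unique surjective isometric algebra isomorphism `Θ : B_A(A*) → (LUC(A*)*, ◻)`
determined by `⟨Θ(T), φ·a⟩ = ⟨Tφ, a⟩`, and it is a homeomorphism for the weak-star
topology of `B(A*)` restricted to `B_A(A*)` and the weak-star topology of
`LUC(A*)*`; (3) `B_A(A*)` is the weak-star closure of `Γ(A)` in `B(A*)`, where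
`Γ(a)(φ) = a·φ`. -/
theorem statement_16
    {A : Type*} [NonUnitalNormedRing A] [NormedSpace ℂ A] [CompleteSpace A]
    [IsScalarTower ℂ A A] [SMulCommClass ℂ A A]
    (hrai : ∃ F : Filter A, F.NeBot ∧ (∀ᶠ e in F, ‖e‖ ≤ 1) ∧
      ∀ a : A, Tendsto (fun e => a * e) F (𝓝 a))
    {U : Type*} [NormedAddCommGroup U] [NormedSpace ℂ U] [CompleteSpace U]
    (ιU : U →ₗ[ℂ] (A →L[ℂ] ℂ)) (hinjU : Function.Injective ιU)
    (hisoU : ∀ u : U, ‖ιU u‖ = ‖u‖)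
    (hrangeU : Set.range ιU = closure
      (Submodule.span ℂ {ψ : A →L[ℂ] ℂ | ∃ (φ : A →L[ℂ] ℂ) (a : A), ψ = dAct φ a} :
        Set (A →L[ℂ] ℂ))) :
    -- the generators `φ·a` lie in `LUC(A*)`
    (∀ (φ : A →L[ℂ] ℂ) (a : A), ∃ u : U, ιU u = dAct φ a) ∧
    -- (1) `LUC(A*)` is left introverted
    (∀ (u : U) (a : A), ∃ w : U, ιU w = dAct (ιU u) a) ∧
    (∃ box : (U →L[ℂ] ℂ) → U → U,
      (∀ (μ : U →L[ℂ] ℂ) (u : U) (a : A) (w : U),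
        ιU w = dAct (ιU u) a → ιU (box μ u) a = μ w) ∧
      -- (2) the isomorphism `Θ`
      ∃ Θ : ((A →L[ℂ] ℂ) →L[ℂ] (A →L[ℂ] ℂ)) → (U →L[ℂ] ℂ),
        -- defining property `⟨Θ(T), φ·a⟩ = ⟨Tφ, a⟩`
        (∀ T ∈ BAset A, ∀ (φ : A →L[ℂ] ℂ) (a : A) (u : U),
          ιU u = dAct φ a → Θ T u = T φ a) ∧
        -- uniqueness
        (∀ Θ' : ((A →L[ℂ] ℂ) →L[ℂ] (A →L[ℂ] ℂ)) → (U →L[ℂ] ℂ),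
          (∀ T ∈ BAset A, ∀ (φ : A →L[ℂ] ℂ) (a : A) (u : U),
            ιU u = dAct φ a → Θ' T u = T φ a) →
          ∀ T ∈ BAset A, Θ' T = Θ T) ∧
        -- isometric, linear, multiplicative, surjective
        (∀ T ∈ BAset A, ‖Θ T‖ = ‖T‖) ∧
        (∀ T T', T ∈ BAset A → T' ∈ BAset A → Θ (T + T') = Θ T + Θ T') ∧
        (∀ (c : ℂ) T, T ∈ BAset A → Θ (c • T) = c • Θ T) ∧
        (∀ T T', T ∈ BAset A → T' ∈ BAset A →
          ∀ ar : (U →L[ℂ] ℂ) → (U →L[ℂ] ℂ) → (U →L[ℂ] ℂ),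
          (∀ μ ν u, ar μ ν u = μ (box ν u)) →
          Θ (T.comp T') = ar (Θ T) (Θ T')) ∧
        (∀ μ : U →L[ℂ] ℂ, ∃ T ∈ BAset A, Θ T = μ) ∧
        -- weak-star–weak-star homeomorphism onto `LUC(A*)*`
        (∃ hom : @Homeomorph {T // T ∈ BAset A} (WeakDual ℂ U)
            (TopologicalSpace.induced Subtype.val (wstarT A)) (by infer_instance),
          ∀ T : {T // T ∈ BAset A}, hom T = toW (Θ T.1))) ∧
    -- (3) `B_A(A*)` is the weak-star closure of `Γ(A)`
    (BAset A = @closure _ (wstarT A) (Set.range (GammaA A))) := by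
  obtain ⟨ι, hι⟩ : ∃ ι : U →ₗᵢ[ℂ] (A →L[ℂ] ℂ), ∀ u, ι u = ιU u := ⟨⟨ιU, hisoU⟩, fun _ => rfl⟩
  have hrange : Set.range ι = closure
      (Submodule.span ℂ {ψ : A →L[ℂ] ℂ | ∃ (φ : A →L[ℂ] ℂ) (a : A), ψ = dAct φ a} :
        Set (A →L[ℂ] ℂ)) := by
    rw [← hrangeU]; congr 1; ext1 u; exact hι u
  simp only [← hι]
  have hr := hrange.subset
  have hgen : ∀ (φ : A →L[ℂ] ℂ) (a : A), ∃ u : U, ι u = dAct φ a := by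
    intro φ a
    have : dAct φ a ∈ Set.range ι := by
      rw [hrange]
      exact subset_closure (Submodule.subset_span ⟨φ, a, rfl⟩)
    exact this
  obtain ⟨E, hE1, hE⟩ := exists_mixed_unit hrai
  choose op hopB hop using exists_opT ι hgen
  have hboxex : ∀ (μ : U →L[ℂ] ℂ) (u : U), ∃ w, ι w = op μ (ι u) := fun μ u =>
    opT_range ι hr hgen (op μ) (hopB μ) u
  choose box hbox using hboxex
  let Θ : ((A →L[ℂ] ℂ) →L[ℂ] (A →L[ℂ] ℂ)) → (U →L[ℂ] ℂ) := fun T =>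
    (E.comp T).comp ι.toContinuousLinearMap
  have hΘa : ∀ T u, Θ T u = E (T (ι u)) := fun T u => rfl
  have hΘ : ∀ T ∈ BAset A, ∀ (φ : A →L[ℂ] ℂ) (a : A) (u : U),
      ι u = dAct φ a → Θ T u = T φ a := by
    intro T hT φ a u hu
    rw [hΘa, hu, hT, hE]
  have hext : ∀ μ ν : U →L[ℂ] ℂ, (∀ φ a u, ι u = dAct φ a → μ u = ν u) → μ = ν := by
    intro μ ν h
    ext u
    have := gen_ext ι hr hgen (LinearMap.ker (μ - ν).toLinearMap)
      (ContinuousLinearMap.isClosed_ker (μ - ν))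
      (fun φ a u hu => by simp [sub_eq_zero, h φ a u hu]) u
    simpa [sub_eq_zero] using this
  have hΘop : ∀ μ, Θ (op μ) = μ := fun μ => hext _ _ fun φ a u hu => by
    rw [hΘ _ (hopB μ) φ a u hu, hop μ φ a u hu]
  have hopΘ : ∀ T ∈ BAset A, op (Θ T) = T := by
    intro T hT
    ext φ a
    obtain ⟨u, hu⟩ := hgen φ a
    rw [hop _ φ a u hu, hΘ T hT φ a u hu]
  -- series representation
  have hseries : ∀ p : (ℕ → (A →L[ℂ] ℂ)) × (ℕ → A), (Summable fun n => ‖p.1 n‖ * ‖p.2 n‖) →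
      ∃ u : U, ∀ T ∈ BAset A, ∑' n, T (p.1 n) (p.2 n) = Θ T u := by
    intro p hp
    choose u hu using fun n => hgen (p.1 n) (p.2 n)
    have hs : Summable u := Summable.of_norm_bounded hp fun n => by
      rw [← ι.norm_map, hu]; exact dAct_norm_le _ _
    refine ⟨∑' n, u n, fun T hT => ?_⟩
    rw [(Θ T).map_tsum hs]
    exact tsum_congr fun n => (hΘ T hT _ _ _ (hu n)).symm
  have hseries' : ∀ u : U, ∃ p : (ℕ → (A →L[ℂ] ℂ)) × (ℕ → A),
      (Summable fun n => ‖p.1 n‖ * ‖p.2 n‖) ∧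
      ∀ T ∈ BAset A, Θ T u = ∑' n, T (p.1 n) (p.2 n) := by
    intro u
    obtain ⟨p, hp, hsum⟩ := exists_series ι hr hgen hrai u
    refine ⟨p, hp, fun T hT => ?_⟩
    have h1 := ((E.comp T).hasSum hsum).tsum_eq
    rw [hΘa]
    refine h1.symm.trans (tsum_congr fun n => ?_)
    show E (T (dAct (p.1 n) (p.2 n))) = _
    rw [hT, hE]
  refine ⟨hgen, fun u a => hgen _ a, ⟨box, ?_, Θ, hΘ, ?_, ?_, ?_, ?_, ?_, ?_, ?_⟩, ?_⟩
  · intro μ u a w hw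
    rw [hbox, hop μ _ _ _ hw]
  · intro Θ' h T hT
    exact hext _ _ fun φ a u hu => by rw [h T hT φ a u hu, hΘ T hT φ a u hu]
  · intro T hT
    apply le_antisymm
    · refine ContinuousLinearMap.opNorm_le_bound _ T.opNorm_nonneg fun u => ?_
      rw [hΘa]
      calc ‖E (T (ι u))‖ ≤ ‖E‖ * ‖T (ι u)‖ := E.le_opNorm _
        _ ≤ 1 * ‖T (ι u)‖ := mul_le_mul_of_nonneg_right hE1 (norm_nonneg _)
        _ ≤ ‖T‖ * ‖u‖ := by rw [one_mul, ← ι.norm_map u]; exact T.le_opNorm _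
    · refine ContinuousLinearMap.opNorm_le_bound _ (norm_nonneg _) fun φ => ?_
      refine ContinuousLinearMap.opNorm_le_bound _ (by positivity) fun a => ?_
      obtain ⟨u, hu⟩ := hgen φ a
      rw [← hΘ T hT φ a u hu, mul_assoc]
      refine ((Θ T).le_opNorm u).trans (mul_le_mul_of_nonneg_left ?_ (norm_nonneg _))
      rw [← ι.norm_map, hu]
      exact dAct_norm_le _ _
  · intro T T' _ _
    ext u
    simp [hΘa]
  · intro c T _
    ext u
    simp [hΘa]
  · intro T T' hT hT' ar har
    ext u
    rw [har, hΘa, hΘa, hbox, hopΘ T' hT']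
    rfl
  · exact fun μ => ⟨op μ, hopB μ, hΘop μ⟩
  · letI : TopologicalSpace {T // T ∈ BAset A} :=
      TopologicalSpace.induced Subtype.val (wstarT A)
    refine ⟨{ toFun := fun T => toW (Θ T.1)
              invFun := fun μ => ⟨op (ofW μ), hopB _⟩
              left_inv := fun T => Subtype.ext (hopΘ T.1 T.2)
              right_inv := fun μ => hΘop (ofW μ)
              continuous_toFun := ?_
              continuous_invFun := ?_ }, fun T => rfl⟩
    · refine WeakDual.continuous_of_continuous_eval fun u => ?_
      obtain ⟨p, hp, h⟩ := hseries' u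
      have h2 : (fun T : {T // T ∈ BAset A} => (toW (Θ T.1)) u) =
          (fun T => ∑' n, T (p.1 n) (p.2 n)) ∘ Subtype.val := by
        funext T
        exact h T.1 T.2
      rw [h2]
      exact @Continuous.comp _ _ _ _ (wstarT A) _ _ _ (wstarT_eval_continuous A p hp)
        (@continuous_induced_dom _ _ _ (wstarT A))
    · refine (@continuous_induced_rng _ _ _ _ _ (wstarT A) _).2 ?_
      unfold wstarT
      refine continuous_iInf_rng.2 fun p => continuous_iInf_rng.2 fun hp =>
        continuous_induced_rng.2 ?_
      obtain ⟨u, hu⟩ := hseries p hp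
      have h2 : ((fun T : (A →L[ℂ] ℂ) →L[ℂ] (A →L[ℂ] ℂ) => ∑' n, T (p.1 n) (p.2 n)) ∘
          Subtype.val ∘ fun μ : WeakDual ℂ U => (⟨op (ofW μ), hopB _⟩ : {T // T ∈ BAset A})) =
          fun μ : WeakDual ℂ U => μ u := by
        funext μ
        show ∑' n, op (ofW μ) (p.1 n) (p.2 n) = μ u
        rw [hu _ (hopB _), hΘop]
        rfl
      exact h2 ▸ WeakDual.eval_continuous u
  · apply Set.Subset.antisymm
    · intro T hT
      refine wstarT_closure A _ T fun I => ?_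
      choose u hu using fun p : {p : (ℕ → (A →L[ℂ] ℂ)) × (ℕ → A) //
        Summable fun n => ‖p.1 n‖ * ‖p.2 n‖} => hseries p.1 p.2
      obtain ⟨a, ha⟩ := finite_match ι (Θ T) I u
      refine ⟨_, ⟨a, rfl⟩, fun p hp => ?_⟩
      rw [hu p _ (GammaA_mem a), hu p T hT, ← ha p hp]
      have : Θ (GammaA A a) = (ContinuousLinearMap.apply ℂ ℂ a).comp
          ι.toContinuousLinearMap := hext _ _ fun φ b v hv => by
        rw [hΘ _ (GammaA_mem a) φ b v hv]
        show _ = ι v a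
        rw [hv]
        rfl
      rw [this]
      rfl
    · refine @closure_minimal _ (wstarT A) _ _ ?_ BAset_closed
      rintro _ ⟨a, rfl⟩
      exact GammaA_mem a

end
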